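/- In the infinitesimal Hecke algebra H_z with z central in U(sl2), any element of H_z that commutes with all of sl2 (i.e. with e, h, f) lies in the subalgebra generated by the central element t_z and the center Z(U(sl2)) = C[Δ]. -/

import Mathlib

noncomputable section

open Polynomial

/-- Free algebra on generators e, h, f, x, y. -/
abbrev F5 : Type := FreeAlgebra ℂ (Fin 5)

def ge : F5 := FreeAlgebra.ι ℂ 0
def gh : F5 := FreeAlgebra.ι ℂ 1
def gf : F5 := FreeAlgebra.ι ℂ 2
def gx : F5 := FreeAlgebra.ι ℂ 3
def gy : F5 := FreeAlgebra.ι ℂ 4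

/-- The shifted Casimir element Δ = h² + 4ef − 2h (as a word in the free algebra). -/
def gΔ : F5 := gh * gh + 4 * (ge * gf) - 2 * gh

/-- Defining relations of the infinitesimal Hecke algebra H_z of sl₂:
sl₂ relations, the standard action on V = span(x,y), and [x,y] = z. -/
inductive HRel (z : F5) : F5 → F5 → Prop
  | he : HRel z (gh * ge) (ge * gh + 2 * ge)
  | hf : HRel z (gh * gf) (gf * gh - 2 * gf)
  | ef : HRel z (ge * gf) (gf * ge + gh)
  | ex : HRel z (ge * gx) (gx * ge)
  | ey : HRel z (ge * gy) (gy * ge + gx)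
  | fx : HRel z (gf * gx) (gx * gf + gy)
  | fy : HRel z (gf * gy) (gy * gf)
  | hx : HRel z (gh * gx) (gx * gh + gx)
  | hy : HRel z (gh * gy) (gy * gh - gy)
  | xy : HRel z (gx * gy) (gy * gx + z)

/-- The infinitesimal Hecke algebra H_z (for z = 0 this is U(sl₂ ⋉ V)). -/
abbrev Hz (z : F5) : Type := RingQuot (HRel z)

/-- Canonical projection from the free algebra. -/
def π (z : F5) : F5 →ₐ[ℂ] Hz z := RingQuot.mkAlgHom ℂ (HRel z)



structure HD {R : Type*} [Ring R] [Algebra ℂ R] (e h f x y z w D t : R) : Prop where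
  he : h * e = e * h + 2 * e
  hf : h * f = f * h - 2 * f
  ef : e * f = f * e + h
  ex : e * x = x * e
  ey : e * y = y * e + x
  fx : f * x = x * f + y
  fy : f * y = y * f
  hx : h * x = x * h + x
  hy : h * y = y * h - y
  xy : x * y = y * x + z
  hD : D = h * h + 4 * (e * f) - 2 * h
  hz : z ∈ Algebra.adjoin ℂ {D}
  hw : w ∈ Algebra.adjoin ℂ {D}
  ht : t = e * y ^ 2 + h * x * y - f * x ^ 2 - (1/2 : ℂ) • (h * z) - w
  top : Algebra.adjoin ℂ {e, h, f, x, y} = ⊤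

/-- inner derivation -/
def ad {R : Type*} [Ring R] [Algebra ℂ R] (a : R) : R →ₗ[ℂ] R :=
  LinearMap.mulLeft ℂ a - LinearMap.mulRight ℂ a

section
variable {R : Type*} [Ring R] [Algebra ℂ R] {e h f x y z w D t : R}

theorem ad_apply (a b : R) : ad a b = a * b - b * a := by simp [ad]

theorem ad_mul (a b c : R) : ad a (b * c) = ad a b * c + b * ad a c := by
  simp only [ad_apply]; noncomm_ring

namespace HD

theorem De (A : HD e h f x y z w D t) : Commute D e := by
  have h1 := A.he; have h2 := A.hf; have h3 := A.ef
  rw [Commute, SemiconjBy, A.hD]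
  linear_combination (norm := noncomm_ring) h * h1 + h1 * h - 4 * e * h3

theorem Df (A : HD e h f x y z w D t) : Commute D f := by
  have h1 := A.he; have h2 := A.hf; have h3 := A.ef
  rw [Commute, SemiconjBy, A.hD]
  linear_combination (norm := noncomm_ring) h * h2 + h2 * h + 4 * h3 * f

theorem Dh (A : HD e h f x y z w D t) : Commute D h := by
  have h1 := A.he; have h2 := A.hf; have h3 := A.ef
  rw [Commute, SemiconjBy, A.hD]
  linear_combination (norm := noncomm_ring) -4 * h1 * f - 4 * e * h2

theorem comm_adj {s : Set R} {a b : R} (hb : b ∈ Algebra.adjoin ℂ s) (H : ∀ c ∈ s, Commute c a) :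
    Commute b a := by
  induction hb using Algebra.adjoin_induction with
  | mem c hc => exact H c hc
  | algebraMap r => exact Algebra.commutes r a
  | add b c _ _ hb hc => exact hb.add_left hc
  | mul b c _ _ hb hc => exact hb.mul_left hc

theorem commD {a b : R} (hb : b ∈ Algebra.adjoin ℂ {D}) (H : Commute D a) : Commute b a :=
  comm_adj hb (by simpa using H)

theorem te (A : HD e h f x y z w D t) : Commute t e := by
  have h1 := A.he; have h2 := A.hf; have h3 := A.ef
  have h4 := A.ex; have h5 := A.ey; have h6 := A.xy
  have hz := (commD A.hz A.De).eq
  have hw := (commD A.hw A.De).eq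
  rw [Commute, SemiconjBy, A.ht]
  have k1 : (h * z) * e - e * (h * z) = 2 * e * z := by
    linear_combination (norm := noncomm_ring) h * hz + h1 * z
  have k2 : (e * y ^ 2 + h * x * y - f * x ^ 2) * e - e * (e * y ^ 2 + h * x * y - f * x ^ 2)
     = e * z := by
    linear_combination (norm := noncomm_ring) -e * h5 * y - e * y * h5 - h * x * h5 - h * h4 * y + h1 * x * y
      + f * h4 * x + f * x * h4 + h3 * x * x + e * h6
  have k3 : (1/2 : ℂ) • (h * z) * e - e * ((1/2 : ℂ) • (h * z)) = e * z := by
    rw [smul_mul_assoc, mul_smul_comm, ← smul_sub, k1, mul_assoc, two_mul, ← two_smul ℂ, smul_smul]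
    norm_num
  linear_combination (norm := noncomm_ring) k2 - k3 - hw

theorem tf (A : HD e h f x y z w D t) : Commute t f := by
  have h1 := A.he; have h2 := A.hf; have h3 := A.ef
  have h4 := A.fx; have h5 := A.fy; have h6 := A.xy
  have hz := (commD A.hz A.Df).eq
  have hw := (commD A.hw A.Df).eq
  rw [Commute, SemiconjBy, A.ht]
  have k1 : (h * z) * f - f * (h * z) = - (2 * f * z) := by
    linear_combination (norm := noncomm_ring) h * hz + h2 * z
  have k2 : (e * y ^ 2 + h * x * y - f * x ^ 2) * f - f * (e * y ^ 2 + h * x * y - f * x ^ 2)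
     = - (f * z) := by
    linear_combination (norm := noncomm_ring) -e * h5 * y - e * y * h5 - h * x * h5 - h * h4 * y + h2 * x * y
      + f * h4 * x + f * x * h4 + h3 * y * y - f * h6
  have k3 : (1/2 : ℂ) • (h * z) * f - f * ((1/2 : ℂ) • (h * z)) = - (f * z) := by
    rw [smul_mul_assoc, mul_smul_comm, ← smul_sub, k1, mul_assoc, two_mul, ← two_smul ℂ, ← smul_neg, smul_smul]
    norm_num
  linear_combination (norm := noncomm_ring) k2 - k3 - hw

theorem th (A : HD e h f x y z w D t) : Commute t h := by
  have h3 := A.ef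
  have : h = e * f - f * e := by rw [h3]; noncomm_ring
  rw [this]
  exact (A.te.mul_right A.tf).sub_right (A.tf.mul_right A.te)

theorem adj_comm (A : HD e h f x y z w D t) {a : R} (ha : a ∈ Algebra.adjoin ℂ {t, D}) :
    Commute a e ∧ Commute a h ∧ Commute a f := by
  refine ⟨comm_adj ha ?_, comm_adj ha ?_, comm_adj ha ?_⟩ <;> simp [A.te, A.th, A.tf, A.De, A.Dh, A.Df]
end HD

/-- N -/
def NN (e h f D t : R) : Submodule ℂ R :=
  Subalgebra.toSubmodule (Algebra.adjoin ℂ {t, D}) ⊔ (LinearMap.range (ad e) ⊔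
    (LinearMap.range (ad h) ⊔ LinearMap.range (ad f)))

theorem mem_NN {v : R} : v ∈ NN e h f D t ↔ ∃ a ∈ Algebra.adjoin ℂ {t, D}, ∃ b c d : R,
    a + (ad e b + (ad h c + ad f d)) = v := by
  simp [NN, Submodule.mem_sup]

theorem ad_e_mem (v : R) : ad e v ∈ NN e h f D t := mem_NN.2 ⟨0, zero_mem _, v, 0, 0, by simp⟩
theorem ad_h_mem (v : R) : ad h v ∈ NN e h f D t := mem_NN.2 ⟨0, zero_mem _, 0, v, 0, by simp⟩
theorem ad_f_mem (v : R) : ad f v ∈ NN e h f D t := mem_NN.2 ⟨0, zero_mem _, 0, 0, v, by simp⟩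
theorem adj_mem {v : R} (hv : v ∈ Algebra.adjoin ℂ {t, D}) : v ∈ NN e h f D t :=
  mem_NN.2 ⟨v, hv, 0, 0, 0, by simp⟩

/-- F n -/
def FF (e h f x y : R) (n : ℕ) : Submodule ℂ R :=
  Submodule.span ℂ {v | ∃ u ∈ Algebra.adjoin ℂ {e, h, f}, ∃ i j, i + j ≤ n ∧ v = u * (y ^ j * x ^ i)}

theorem FF_mem {u : R} (hu : u ∈ Algebra.adjoin ℂ {e, h, f}) {i j n : ℕ} (hij : i + j ≤ n) :
    u * (y ^ j * x ^ i) ∈ FF e h f x y n := Submodule.subset_span ⟨u, hu, i, j, hij, rfl⟩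

theorem FF_mono {m n : ℕ} (hmn : m ≤ n) : FF e h f x y m ≤ FF e h f x y n :=
  Submodule.span_mono (by rintro v ⟨u, hu, i, j, hij, rfl⟩; exact ⟨u, hu, i, j, hij.trans hmn, rfl⟩)

/-- induct on FF -/
theorem FF_le {n : ℕ} {S : Submodule ℂ R} (φ : R →ₗ[ℂ] R)
    (H : ∀ u ∈ Algebra.adjoin ℂ {e, h, f}, ∀ i j, i + j ≤ n → φ (u * (y ^ j * x ^ i)) ∈ S) {v : R}
    (hv : v ∈ FF e h f x y n) : φ v ∈ S := by
  have : FF e h f x y n ≤ S.comap φ := Submodule.span_le.2 (by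
    rintro v ⟨u, hu, i, j, hij, rfl⟩; exact H u hu i j hij)
  exact this hv

theorem UFF {u v : R} {n : ℕ} (hu : u ∈ Algebra.adjoin ℂ {e, h, f}) (hv : v ∈ FF e h f x y n) :
    u * v ∈ FF e h f x y n := by
  refine FF_le (LinearMap.mulLeft ℂ u) ?_ hv
  intro u' hu' i j hij
  simp only [LinearMap.mulLeft_apply, ← mul_assoc u]
  exact FF_mem (mul_mem hu hu') hij

namespace HD

theorem A_mul_N (A : HD e h f x y z w D t) {a v : R} (ha : a ∈ Algebra.adjoin ℂ {t, D}) (hv : v ∈ NN e h f D t) :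
    a * v ∈ NN e h f D t := by
  obtain ⟨b, hb, c, d, g, rfl⟩ := mem_NN.1 hv
  obtain ⟨h1, h2, h3⟩ := A.adj_comm ha
  refine mem_NN.2 ⟨a * b, mul_mem ha hb, a * c, a * d, a * g, ?_⟩
  simp only [ad_mul]
  simp only [ad_apply, h1.eq, h2.eq, h3.eq]
  noncomm_ring

theorem eU : e ∈ Algebra.adjoin ℂ {e, h, f} := Algebra.subset_adjoin (by simp)
theorem hU : h ∈ Algebra.adjoin ℂ {e, h, f} := Algebra.subset_adjoin (by simp)
theorem fU : f ∈ Algebra.adjoin ℂ {e, h, f} := Algebra.subset_adjoin (by simp)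

theorem DU (A : HD e h f x y z w D t) : D ∈ Algebra.adjoin ℂ {e, h, f} := by
  rw [A.hD]
  have h4 : (4 : R) ∈ Algebra.adjoin ℂ {e, h, f} := ofNat_mem _ 4
  have h2 : (2 : R) ∈ Algebra.adjoin ℂ {e, h, f} := ofNat_mem _ 2
  exact sub_mem (add_mem (mul_mem hU hU) (mul_mem h4 (mul_mem eU fU))) (mul_mem h2 hU)

theorem DU' (A : HD e h f x y z w D t) {v : R} (hv : v ∈ Algebra.adjoin ℂ {D}) : v ∈ Algebra.adjoin ℂ {e, h, f} :=
  Algebra.adjoin_le (by simpa using A.DU) hv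

theorem xyU (A : HD e h f x y z w D t) {u : R} (hu : u ∈ Algebra.adjoin ℂ {e, h, f}) :
    (∃ a ∈ Algebra.adjoin ℂ {e, h, f}, ∃ b ∈ Algebra.adjoin ℂ {e, h, f}, x * u = a * x + b * y) ∧
    (∃ a ∈ Algebra.adjoin ℂ {e, h, f}, ∃ b ∈ Algebra.adjoin ℂ {e, h, f}, y * u = a * x + b * y) := by
  induction hu using Algebra.adjoin_induction with
  | mem c hc =>
    rcases hc with rfl | rfl | rfl
    · exact ⟨⟨c, eU, 0, zero_mem _, by simp [A.ex]⟩,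
        ⟨-1, neg_mem (one_mem _), c, eU, by rw [A.ey]; noncomm_ring⟩⟩
    · exact ⟨⟨c - 1, sub_mem hU (one_mem _), 0, zero_mem _, by rw [sub_mul, A.hx]; noncomm_ring⟩,
        ⟨0, zero_mem _, c + 1, add_mem hU (one_mem _), by rw [add_mul, A.hy]; noncomm_ring⟩⟩
    · exact ⟨⟨c, fU, -1, neg_mem (one_mem _), by rw [A.fx]; noncomm_ring⟩,
        ⟨0, zero_mem _, c, fU, by rw [A.fy]; noncomm_ring⟩⟩
  | algebraMap r =>
    exact ⟨⟨algebraMap _ _ r, Subalgebra.algebraMap_mem _ r, 0, zero_mem _, by simp [Algebra.commutes r x]⟩,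
      ⟨0, zero_mem _, algebraMap _ _ r, Subalgebra.algebraMap_mem _ r, by simp [Algebra.commutes r y]⟩⟩
  | add b c _ _ hb hc =>
    obtain ⟨⟨a1, m1, a2, m2, E1⟩, ⟨a3, m3, a4, m4, E2⟩⟩ := hb
    obtain ⟨⟨b1, n1, b2, n2, E3⟩, ⟨b3, n3, b4, n4, E4⟩⟩ := hc
    exact ⟨⟨_, add_mem m1 n1, _, add_mem m2 n2, by rw [mul_add, E1, E3]; noncomm_ring⟩,
      ⟨_, add_mem m3 n3, _, add_mem m4 n4, by rw [mul_add, E2, E4]; noncomm_ring⟩⟩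
  | mul b c _ _ hb hc =>
    obtain ⟨⟨a1, m1, a2, m2, E1⟩, ⟨a3, m3, a4, m4, E2⟩⟩ := hb
    obtain ⟨⟨b1, n1, b2, n2, E3⟩, ⟨b3, n3, b4, n4, E4⟩⟩ := hc
    exact ⟨⟨_, add_mem (mul_mem m1 n1) (mul_mem m2 n3), _, add_mem (mul_mem m1 n2) (mul_mem m2 n4),
        by rw [← mul_assoc, E1, add_mul, mul_assoc, E3, mul_assoc, E4]; noncomm_ring⟩,
      ⟨_, add_mem (mul_mem m3 n1) (mul_mem m4 n3), _, add_mem (mul_mem m3 n2) (mul_mem m4 n4),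
        by rw [← mul_assoc, E2, add_mul, mul_assoc, E3, mul_assoc, E4]; noncomm_ring⟩⟩

theorem zU (A : HD e h f x y z w D t) : z ∈ Algebra.adjoin ℂ {e, h, f} := A.DU' A.hz

theorem xyF (A : HD e h f x y z w D t) (n : ℕ) : (∀ v ∈ FF e h f x y n, x * v ∈ FF e h f x y (n+1)) ∧
    (∀ v ∈ FF e h f x y n, y * v ∈ FF e h f x y (n+1)) := by
  induction n using Nat.strong_induction_on with
  | _ n IH =>
  have c : ∀ j i, i + j ≤ n → x * (y ^ j * x ^ i) - y ^ j * x ^ (i+1) ∈ FF e h f x y (i + j) := by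
    intro j
    induction j with
    | zero => intro i _; simp [pow_succ']
    | succ j ih =>
      intro i hij
      have h1 := (IH (i + j) (by omega)).2 _ (ih i (by omega))
      rw [add_assoc] at h1
      have h2 : z * (y ^ j * x ^ i) ∈ FF e h f x y (i + (j + 1)) := FF_mem A.zU (by omega)
      convert add_mem h1 h2 using 1
      have := A.xy
      rw [pow_succ' y]
      linear_combination (norm := noncomm_ring) this * y ^ j * x ^ i
  have cc1 : ∀ j i, i + j ≤ n → x * (y ^ j * x ^ i) ∈ FF e h f x y (n + 1) := by
    intro j i hij
    have h1 := FF_mono (show i + j ≤ n + 1 by omega) (c j i hij)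
    have h2 : (1 : R) * (y ^ j * x ^ (i + 1)) ∈ FF e h f x y (n + 1) := FF_mem (one_mem _) (by omega)
    convert add_mem h1 h2 using 1
    noncomm_ring
  have cc2 : ∀ j i, i + j ≤ n → y * (y ^ j * x ^ i) ∈ FF e h f x y (n + 1) := by
    intro j i hij
    have h2 : (1 : R) * (y ^ (j + 1) * x ^ i) ∈ FF e h f x y (n + 1) := FF_mem (one_mem _) (by omega)
    convert h2 using 1
    rw [one_mul, pow_succ', mul_assoc]
  constructor
  · intro v hv
    refine FF_le (LinearMap.mulLeft ℂ x) ?_ hv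
    intro u hu i j hij
    obtain ⟨a, ha, b, hb, E⟩ := (A.xyU hu).1
    rw [LinearMap.mulLeft_apply, ← mul_assoc, E, add_mul, mul_assoc, mul_assoc]
    exact add_mem (UFF ha (cc1 j i hij)) (UFF hb (cc2 j i hij))
  · intro v hv
    refine FF_le (LinearMap.mulLeft ℂ y) ?_ hv
    intro u hu i j hij
    obtain ⟨a, ha, b, hb, E⟩ := (A.xyU hu).2
    rw [LinearMap.mulLeft_apply, ← mul_assoc, E, add_mul, mul_assoc, mul_assoc]
    exact add_mem (UFF ha (cc1 j i hij)) (UFF hb (cc2 j i hij))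

theorem yjF (A : HD e h f x y z w D t) {v : R} {n : ℕ} (j : ℕ) (hv : v ∈ FF e h f x y n) : y ^ j * v ∈ FF e h f x y (n + j) := by
  induction j with
  | zero => simpa
  | succ j ih => rw [pow_succ', mul_assoc]; exact (A.xyF _).2 _ ih

theorem exhaust (A : HD e h f x y z w D t) (r : R) : ∃ n, r ∈ FF e h f x y n := by
  have hr : r ∈ Algebra.adjoin ℂ {e, h, f, x, y} := by rw [A.top]; trivial
  have : ∀ n, ∀ v ∈ FF e h f x y n, ∃ m, r * v ∈ FF e h f x y m := by
    induction hr using Algebra.adjoin_induction with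
    | mem c hc =>
      intro n v hv
      rcases hc with rfl | rfl | rfl | rfl | rfl
      · exact ⟨n, UFF eU hv⟩
      · exact ⟨n, UFF hU hv⟩
      · exact ⟨n, UFF fU hv⟩
      · exact ⟨n + 1, (A.xyF n).1 v hv⟩
      · exact ⟨n + 1, (A.xyF n).2 v hv⟩
    | algebraMap r =>
      intro n v hv
      exact ⟨n, by rw [← Algebra.smul_def]; exact Submodule.smul_mem _ _ hv⟩
    | add b c _ _ hb hc =>
      intro n v hv
      obtain ⟨m, hm⟩ := hb n v hv
      obtain ⟨k, hk⟩ := hc n v hv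
      exact ⟨m + k, by rw [add_mul]; exact add_mem (FF_mono (by omega) hm) (FF_mono (by omega) hk)⟩
    | mul b c _ _ hb hc =>
      intro n v hv
      obtain ⟨m, hm⟩ := hc n v hv
      obtain ⟨k, hk⟩ := hb m _ hm
      exact ⟨k, by rwa [mul_assoc]⟩
  simpa using this 0 (1 * (y ^ 0 * x ^ 0)) (FF_mem (one_mem _) (by simp))

theorem fxi (A : HD e h f x y z w D t) (i : ℕ) : ad f (x ^ (i + 1)) - ((i : ℂ) + 1) • (y * x ^ i) ∈ FF e h f x y i := by
  induction i with
  | zero => simp [ad_apply, A.fx]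
  | succ i ih =>
    have h1 := (A.xyF i).1 _ ih
    have h2 : z * (y ^ 0 * x ^ i) ∈ FF e h f x y (i + 1) := FF_mem A.zU (by omega)
    convert add_mem h1 (Submodule.smul_mem _ ((i : ℂ) + 1) h2) using 1
    rw [pow_succ' x (i + 1), ad_mul, mul_sub, mul_smul_comm, ← mul_assoc x y, A.xy]
    simp only [ad_apply f x, A.fx, pow_zero, one_mul, Nat.cast_add, Nat.cast_one]
    rw [add_smul _ (1 : ℂ), one_smul, add_mul, smul_add, pow_succ' x i]
    noncomm_ring

/-- key congruence -/
theorem key (A : HD e h f x y z w D t) {n i j : ℕ} (hn : FF e h f x y n ≤ NN e h f D t) (hij : i + j ≤ n) {u : R}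
    (hu : u ∈ Algebra.adjoin ℂ {e, h, f}) :
    ((i : ℂ) + 1) • (u * (y ^ (j + 1) * x ^ i)) + ad f u * (y ^ j * x ^ (i + 1)) ∈ NN e h f D t := by
  have h1 : ad f (u * (y ^ j * x ^ (i + 1))) ∈ NN e h f D t := ad_f_mem _
  have h2 := hn (FF_mono hij (UFF hu (A.yjF j (A.fxi i))))
  convert sub_mem h1 h2 using 1
  have h3 : ad f (y ^ j) = 0 := by
    have : Commute f (y ^ j) := Commute.pow_right A.fy j
    rw [ad_apply, this.eq, sub_self]
  rw [ad_mul f u, ad_mul f (y ^ j), h3, mul_sub, mul_sub, mul_smul_comm, mul_smul_comm, pow_succ y j]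
  noncomm_ring

theorem fkx (A : HD e h f x y z w D t) (k : ℕ) (hn : ∀ m < 2 * k, FF e h f x y m ≤ NN e h f D t) :
    f ^ k * x ^ (2 * k) ∈ NN e h f D t := by
  rcases k with _ | k
  · simpa using adj_mem (e := e) (h := h) (f := f) (t := t) (D := D) (one_mem _)
  have fkU : f ^ k ∈ Algebra.adjoin ℂ {e, h, f} := pow_mem fU k
  have c1 := A.key (hn (2 * k + 1) (by omega)) (i := 2 * k + 1) (j := 0) (by omega) (mul_mem fkU hU)
  have c2 := A.key (hn (2 * k + 1) (by omega)) (i := 2 * k) (j := 1) (by omega) (mul_mem fkU eU)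
  have adk : ad f (f ^ k) = 0 := by
    rw [ad_apply, (Commute.self_pow f k).eq, sub_self]
  have adh : ad f h = 2 * f := by rw [ad_apply, A.hf]; noncomm_ring
  have ade : ad f e = - h := by rw [ad_apply, A.ef]; noncomm_ring
  rw [ad_mul, adk, adh] at c1
  rw [ad_mul, adk, ade] at c2
  have c3 : t * (f ^ k * x ^ (2 * k)) ∈ NN e h f D t := by
    refine A.A_mul_N (Algebra.subset_adjoin (by simp)) (hn (2 * k) (by omega) ?_)
    simpa using FF_mem (x := x) (y := y) (j := 0) fkU (le_refl (2 * k))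
  have hx : x ^ (2 * k) ∈ FF e h f x y (2 * k) := by
    simpa using FF_mem (x := x) (y := y) (j := 0) (one_mem _) (le_refl (2 * k))
  have c4 : f ^ k * ((1/2 : ℂ) • (h * z) - w) * x ^ (2 * k) ∈ NN e h f D t := by
    refine hn (2 * k) (by omega) (UFF (mul_mem fkU (sub_mem ?_ ?_)) hx)
    · exact Subalgebra.smul_mem _ (mul_mem hU A.zU) _
    · exact A.DU' A.hw
  have E : t * (f ^ k * x ^ (2 * k)) = f ^ k * e * (y ^ 2 * x ^ (2 * k))
      + f ^ k * h * (y ^ 1 * x ^ (2 * k + 1)) - f ^ (k + 1) * x ^ (2 * k + 2)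
      + f ^ k * ((1/2 : ℂ) • (h * z) - w) * x ^ (2 * k) := by
    rw [← mul_assoc, (A.tf.pow_right k).eq, A.ht, mul_assoc h x y, A.xy]
    have : (1/2 : ℂ) • (h * z) + (1/2 : ℂ) • (h * z) = h * z := by
      rw [← add_smul]; norm_num
    rw [pow_succ' x (2 * k + 1), pow_succ' x (2 * k), pow_succ f k]
    linear_combination (norm := noncomm_ring) - (f ^ k * this * x ^ (2 * k))
  rw [E] at c3
  have c5 := sub_mem c3 c4
  have c6 := sub_mem (sub_mem (Submodule.smul_mem _ (2 * k + 1 : ℂ) c5) c2) c1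
  have c7 := Submodule.smul_mem _ (-(2 * k + 3 : ℂ)⁻¹) c6
  have hne : (2 * k + 3 : ℂ) ≠ 0 := by exact_mod_cast (by omega : 2 * k + 3 ≠ 0)
  convert c7 using 1
  rw [neg_smul, ← smul_neg, eq_inv_smul_iff₀ hne]
  rw [show 2 * (k + 1) = 2 * k + 2 by ring]
  have g1 : f ^ k * (2 * f) = (2 : ℂ) • f ^ (k + 1) := by
    rw [two_smul, pow_succ]; noncomm_ring
  simp only [zero_mul, zero_add, g1, mul_neg, neg_mul, smul_mul_assoc, pow_zero, one_mul]
  push_cast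
  simp only [add_sub_cancel_right]
  module
end HD
end


section
theorem degR (m : ℕ) : X * (X - 2 : ℂ[X]) ^ m - (X ^ (m + 1) - (2 * m : ℂ[X]) * X ^ m) ∈ degreeLT ℂ m := by
  have hX : ∀ {n} {r : ℂ[X]}, r ∈ degreeLT ℂ n → X * r ∈ degreeLT ℂ (n + 1) := by
    intro n r hr
    rw [mem_degreeLT] at *
    rw [degree_mul, degree_X, add_comm]
    push_cast
    exact WithBot.add_lt_add_right (by simp) hr
  induction m with
  | zero => simp
  | succ m ih =>
    have h1 := hX ih
    have h2 : (X : ℂ[X]) ^ m ∈ degreeLT ℂ (m + 1) := by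
      rw [mem_degreeLT, degree_X_pow]; exact_mod_cast Nat.lt_succ_self m
    have h3 := degreeLT_mono (Nat.le_succ m) ih
    convert add_mem (sub_mem h1 (Submodule.smul_mem _ (2 : ℂ) h3)) (Submodule.smul_mem _ (4 * m : ℂ) h2) using 1
    simp only [smul_eq_C_mul, map_mul, map_ofNat, map_natCast]
    push_cast
    ring

theorem degR' (m : ℕ) (k : ℂ) : -(X^2-2*X) * (X - 2 : ℂ[X]) ^ m + X^m * ((X + 2 * C k)^2 + 2 * (X + 2 * C k))
     - C (2 * m + 4 * k + 4) * X ^ (m + 1) ∈ degreeLT ℂ (m + 1) := by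
  have hX : ∀ {n} {r : ℂ[X]}, r ∈ degreeLT ℂ n → X * r ∈ degreeLT ℂ (n + 1) := by
    intro n r hr
    rw [mem_degreeLT] at *
    rw [degree_mul, degree_X, add_comm]
    push_cast
    exact WithBot.add_lt_add_right (by simp) hr
  have ih := degR m
  have h1 := hX ih
  have h2 : (X : ℂ[X]) ^ m ∈ degreeLT ℂ (m + 1) := by
    rw [mem_degreeLT, degree_X_pow]; exact_mod_cast Nat.lt_succ_self m
  have h3 := degreeLT_mono (Nat.le_succ m) ih
  convert add_mem (sub_mem (Submodule.smul_mem _ (2 : ℂ) h3) h1) (Submodule.smul_mem _ (4 * k ^ 2 + 4 * k - 4 * m : ℂ) h2) using 1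
  simp only [smul_eq_C_mul, map_mul, map_ofNat, map_natCast, map_add, map_sub, map_pow]
  ring

theorem degS (m : ℕ) : (X - 2 : ℂ[X]) ^ m - X ^ m ∈ degreeLT ℂ (m + 1) := by
  have h2 : (X : ℂ[X]) ^ m ∈ degreeLT ℂ (m + 1) := by
    rw [mem_degreeLT, degree_X_pow]; exact_mod_cast Nat.lt_succ_self m
  refine sub_mem ?_ h2
  rw [mem_degreeLT, degree_pow, show (X - 2 : ℂ[X]) = X - C 2 by rw [map_ofNat], degree_X_sub_C]
  simp
  exact_mod_cast Nat.lt_succ_self m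

variable {R : Type*} [Ring R] [Algebra ℂ R] {e h f x y z w D t : R}

theorem semi_aeval {a b c : R} (H : SemiconjBy a b c) (q : ℂ[X]) : a * aeval b q = aeval c q * a := by
  induction q using Polynomial.induction_on' with
  | add p q hp hq => simp [mul_add, add_mul, hp, hq]
  | monomial n r =>
    rw [aeval_monomial, aeval_monomial, ← mul_assoc, ← Algebra.commutes r a, mul_assoc, (H.pow_right n).eq, mul_assoc]

/-- span -/
def WW (e h f D : R) : Submodule ℂ R :=
  Submodule.span ℂ {v | ∃ (i k : ℕ) (q : ℂ[X]), v = D ^ i * (aeval h q * f ^ k) ∨ v = D ^ i * (aeval h q * e ^ k)}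

theorem Wf (i k : ℕ) (q : ℂ[X]) : D ^ i * (aeval h q * f ^ k) ∈ WW e h f D :=
  Submodule.subset_span ⟨i, k, q, Or.inl rfl⟩
theorem We (i k : ℕ) (q : ℂ[X]) : D ^ i * (aeval h q * e ^ k) ∈ WW e h f D :=
  Submodule.subset_span ⟨i, k, q, Or.inr rfl⟩

namespace HD

theorem semi_e (A : HD e h f x y z w D t) : SemiconjBy e h (h - 2) := by
  have := A.he
  rw [SemiconjBy]; linear_combination (norm := noncomm_ring) -this
theorem semi_f (A : HD e h f x y z w D t) : SemiconjBy f h (h + 2) := by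
  have := A.hf
  rw [SemiconjBy]; linear_combination (norm := noncomm_ring) -this

theorem e_q (A : HD e h f x y z w D t) (q : ℂ[X]) : e * aeval h q = aeval h (q.comp (X - 2)) * e := by
  rw [semi_aeval A.semi_e, aeval_comp]; simp [map_ofNat]
theorem f_q (A : HD e h f x y z w D t) (q : ℂ[X]) : f * aeval h q = aeval h (q.comp (X + 2)) * f := by
  rw [semi_aeval A.semi_f, aeval_comp]; simp [map_ofNat]

theorem ef' (A : HD e h f x y z w D t) : e * f = (1/4 : ℂ) • (D - aeval h (X^2 - 2*X : ℂ[X])) := by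
  have : (4 : ℂ) • (e * f) = D - aeval h (X^2 - 2*X : ℂ[X]) := by
    rw [A.hD, Algebra.smul_def]; simp [map_ofNat]; noncomm_ring
  rw [← this, smul_smul]; norm_num
theorem fe' (A : HD e h f x y z w D t) : f * e = (1/4 : ℂ) • (D - aeval h (X^2 + 2*X : ℂ[X])) := by
  have : (4 : ℂ) • (f * e) = D - aeval h (X^2 + 2*X : ℂ[X]) := by
    have := A.ef
    rw [A.hD, Algebra.smul_def]; simp [map_ofNat]
    linear_combination (norm := noncomm_ring) -4 * this
  rw [← this, smul_smul]; norm_num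

theorem Dq (A : HD e h f x y z w D t) (q : ℂ[X]) (i : ℕ) : Commute (D ^ i) (aeval h q) := by
  have := semi_aeval (A.Dh.pow_left i) q
  exact this

theorem mulW {g : R} (H : ∀ (i k : ℕ) (q : ℂ[X]), g * (D ^ i * (aeval h q * f ^ k)) ∈ WW e h f D ∧
    g * (D ^ i * (aeval h q * e ^ k)) ∈ WW e h f D) {v : R} (hv : v ∈ WW e h f D) : g * v ∈ WW e h f D := by
  have : WW e h f D ≤ (WW e h f D).comap (LinearMap.mulLeft ℂ g) := Submodule.span_le.2 (by
    rintro v ⟨i, k, q, rfl | rfl⟩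
    · exact (H i k q).1
    · exact (H i k q).2)
  exact this hv

theorem U_le (A : HD e h f x y z w D t) {u : R} (hu : u ∈ Algebra.adjoin ℂ {e, h, f}) : u ∈ WW e h f D := by
  have : ∀ v ∈ WW e h f D, u * v ∈ WW e h f D := by
    induction hu using Algebra.adjoin_induction with
    | mem c hc =>
      intro v hv
      refine mulW ?_ hv
      intro i k q
      rcases hc with rfl | rfl | rfl
      · have E : ∀ v, c * (D ^ i * (aeval h q * v)) = D ^ i * (aeval h (q.comp (X - 2)) * (c * v)) := by
          intro v
          rw [← mul_assoc, ← (A.De.pow_left i).eq, mul_assoc, ← mul_assoc c, A.e_q, mul_assoc]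
        rw [E, E]
        constructor
        · rcases k with _ | k
          · simpa using We i 1 (q.comp (X - 2))
          · rw [pow_succ', ← mul_assoc c, A.ef']
            have h1 := Wf (f := f) (h := h) (D := D) (e := c) (i + 1) k (q.comp (X - 2))
            have h2 := Wf (f := f) (h := h) (D := D) (e := c) i k (q.comp (X - 2) * (X ^ 2 - 2 * X))
            convert Submodule.smul_mem _ (1/4 : ℂ) (sub_mem h1 h2) using 1
            simp only [smul_mul_assoc, mul_smul_comm]
            congr 1
            rw [map_mul, pow_succ D, mul_assoc (D ^ i), ← mul_assoc D, ← pow_one D, (A.Dq _ 1).eq, pow_one]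
            noncomm_ring
        · rw [← pow_succ']; exact We _ _ _
      · have E : ∀ v, c * (D ^ i * (aeval c q * v)) = D ^ i * (aeval c (X * q) * v) := by
          intro v
          rw [← mul_assoc, ← (A.Dh.pow_left i).eq, map_mul, aeval_X]; noncomm_ring
        rw [E, E]
        exact ⟨Wf _ _ _, We _ _ _⟩
      · have E : ∀ v, c * (D ^ i * (aeval h q * v)) = D ^ i * (aeval h (q.comp (X + 2)) * (c * v)) := by
          intro v
          rw [← mul_assoc, ← (A.Df.pow_left i).eq, mul_assoc, ← mul_assoc c, A.f_q, mul_assoc]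
        rw [E, E]
        constructor
        · rw [← pow_succ']; exact Wf _ _ _
        · rcases k with _ | k
          · simpa using Wf i 1 (q.comp (X + 2))
          · rw [pow_succ', ← mul_assoc c, A.fe']
            have h1 := We (e := e) (h := h) (D := D) (f := c) (i + 1) k (q.comp (X + 2))
            have h2 := We (e := e) (h := h) (D := D) (f := c) i k (q.comp (X + 2) * (X ^ 2 + 2 * X))
            convert Submodule.smul_mem _ (1/4 : ℂ) (sub_mem h1 h2) using 1
            simp only [smul_mul_assoc, mul_smul_comm]
            congr 1
            rw [map_mul, pow_succ D, mul_assoc (D ^ i), ← mul_assoc D, ← pow_one D, (A.Dq _ 1).eq, pow_one]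
            noncomm_ring
    | algebraMap r =>
      intro v hv
      rw [← Algebra.smul_def]; exact Submodule.smul_mem _ _ hv
    | add b c _ _ hb hc =>
      intro v hv
      rw [add_mul]; exact add_mem (hb v hv) (hc v hv)
    | mul b c _ _ hb hc =>
      intro v hv
      rw [mul_assoc]; exact hb _ (hc _ hv)
  simpa using this _ (Wf 0 0 1)

theorem hfk (A : HD e h f x y z w D t) (k : ℕ) : f ^ k * h = (h + 2 * k) * f ^ k := by
  induction k with
  | zero => simp
  | succ k ih =>
    have := A.hf
    rw [pow_succ']
    push_cast
    have c : (k : R) * f = f * k := (Nat.cast_commute k f).eq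
    linear_combination (norm := noncomm_ring) f * ih - this * f ^ k - 2 * c * f ^ k

theorem hek (A : HD e h f x y z w D t) (k : ℕ) : h * e ^ k = e ^ k * h + (2 * k : ℂ) • e ^ k := by
  induction k with
  | zero => simp
  | succ k ih =>
    have := A.he
    have h2 : 2 * e * e ^ k = (2 : ℂ) • e ^ (k + 1) := by
      rw [two_smul, pow_succ']; noncomm_ring
    rw [pow_succ', ← mul_assoc, this, add_mul, mul_assoc, ih, mul_add, mul_smul_comm, ← mul_assoc, ← pow_succ', h2]
    push_cast
    module

theorem hxk (A : HD e h f x y z w D t) (k : ℕ) : h * x ^ k = x ^ k * h + (k : ℂ) • x ^ k := by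
  induction k with
  | zero => simp
  | succ k ih =>
    have := A.hx
    rw [pow_succ', ← mul_assoc, this, add_mul, mul_assoc, ih, mul_add, mul_smul_comm, ← mul_assoc, ← pow_succ']
    push_cast
    module

theorem hfk' (A : HD e h f x y z w D t) (k : ℕ) : h * f ^ k = f ^ k * h - (2 * k : ℂ) • f ^ k := by
  rw [A.hfk, add_mul, Algebra.smul_def]; simp [map_ofNat]

theorem hjfk (A : HD e h f x y z w D t) (k : ℕ) (hn : ∀ m < 2 * k, FF e h f x y m ≤ NN e h f D t) (j : ℕ) :
    h ^ j * (f ^ k * x ^ (2 * k)) ∈ NN e h f D t := by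
  induction j using Nat.strong_induction_on with
  | _ j IH =>
  rcases j with _ | m
  · simpa using A.fkx k hn
  set v := f ^ k * x ^ (2 * k) with hv
  let ψ : ℂ[X] →ₗ[ℂ] R := (LinearMap.mulRight ℂ v) ∘ₗ (aeval h).toLinearMap
  have hψ : ∀ q, ψ q = aeval h q * v := fun q => rfl
  have low : degreeLT ℂ (m + 1) ≤ (NN e h f D t).comap ψ := by
    rw [degreeLT_eq_span_X_pow, Submodule.span_le]
    intro q hq
    simp only [Finset.coe_image, Finset.coe_range, Set.mem_image, Set.mem_Iio] at hq
    obtain ⟨i, hi, rfl⟩ := hq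
    simpa [hψ] using IH i hi
  have c1 : ad e (h ^ m * (f ^ (k + 1) * x ^ (2 * k))) ∈ NN e h f D t := ad_e_mem _
  have c2 : D * ψ ((X - 2) ^ m - X ^ m) ∈ NN e h f D t :=
    A.A_mul_N (Algebra.subset_adjoin (by simp)) (low (degS m))
  have c3 := low (degR' m k)
  rw [Submodule.mem_comap, map_sub] at c3
  have E : (4 : ℂ) • ad e (h ^ m * (f ^ (k + 1) * x ^ (2 * k))) = D * ψ ((X - 2) ^ m - X ^ m)
      + ψ (-(X^2-2*X) * (X - 2 : ℂ[X]) ^ m + X^m * ((X + 2 * C (k : ℂ))^2 + 2 * (X + 2 * C (k : ℂ)))) := by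
    simp only [hψ]
    have e1 : e * h ^ m = (h - 2) ^ m * e := (A.semi_e.pow_right m).eq
    have e2 : (4 : R) * (e * f) = D - h * h + 2 * h := by rw [A.hD]; noncomm_ring
    have e3 : (4 : R) * (f * e) = D - h * h - 2 * h := by
      have := A.ef
      rw [A.hD]; linear_combination (norm := noncomm_ring) -4 * this
    have e4 : x ^ (2 * k) * e = e * x ^ (2 * k) := (Commute.pow_right A.ex _).eq.symm
    have e5 := A.hfk k
    have e6 : f ^ k * D = D * f ^ k := (A.Df.pow_right k).eq.symm
    have e7 : (h - 2) ^ m * D = D * (h - 2) ^ m := by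
      have : Commute D (h - 2) := A.Dh.sub_right (Nat.cast_commute 2 D).symm
      exact (this.pow_right m).eq.symm
    have e8 : h ^ m * D = D * h ^ m := (A.Dh.pow_right m).eq.symm
    have e9 : f ^ k * (4 * (f * e)) = (D - (h + 2 * k) * (h + 2 * k) - 2 * (h + 2 * k)) * f ^ k := by
      rw [e3]
      linear_combination (norm := noncomm_ring) e6 - e5 * h - (h + 2 * k) * e5 - 2 * e5
    have e10 : (h - 2) ^ m * (h * h - 2 * h) = (h * h - 2 * h) * (h - 2) ^ m := by
      have : Commute (h * h - 2 * h) (h - 2) := by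
        rw [Commute, SemiconjBy]; noncomm_ring
      exact (this.pow_right m).eq.symm
    rw [ad_apply, Algebra.smul_def, map_ofNat]
    simp only [map_add, map_sub, map_mul, map_neg, map_pow, aeval_X, map_ofNat, map_natCast]
    rw [hv, pow_succ' f, ← pow_succ', pow_succ f]
    have T1 : 4 * (e * (h ^ m * (f ^ k * f * x ^ (2 * k)))) =
       (h - 2) ^ m * (D - h * h + 2 * h) * (f ^ k * x ^ (2 * k)) := by
      rw [← e2, ← mul_assoc e, e1, ← pow_succ, pow_succ']
      noncomm_ring
    have T2 : 4 * (h ^ m * (f ^ k * f * x ^ (2 * k)) * e) =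
       h ^ m * ((D - (h + 2 * k) * (h + 2 * k) - 2 * (h + 2 * k)) * f ^ k) * x ^ (2 * k) := by
      rw [← e9, mul_assoc (h ^ m), mul_assoc _ (x ^ (2 * k)) e, e4]
      noncomm_ring
    rw [mul_sub, T1, T2]
    linear_combination (norm := noncomm_ring) e7 * f ^ k * x ^ (2 * k) - e8 * f ^ k * x ^ (2 * k) - e10 * f ^ k * x ^ (2 * k)
  have c4 := sub_mem (Submodule.smul_mem _ (4 : ℂ) c1) c2
  rw [E, add_sub_cancel_left] at c4
  have c5 := sub_mem c4 c3
  rw [sub_sub_cancel, hψ] at c5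
  have hne : (2 * m + 4 * k + 4 : ℂ) ≠ 0 := by exact_mod_cast (by omega : 2 * m + 4 * k + 4 ≠ 0)
  have c6 := Submodule.smul_mem _ (2 * m + 4 * k + 4 : ℂ)⁻¹ c5
  convert c6 using 1
  rw [eq_inv_smul_iff₀ hne, map_mul, aeval_C, ← Algebra.smul_def, smul_mul_assoc, map_pow, aeval_X]

theorem Ux (A : HD e h f x y z w D t) (n : ℕ) (hn : ∀ m < n, FF e h f x y m ≤ NN e h f D t) {u : R}
    (hu : u ∈ Algebra.adjoin ℂ {e, h, f}) : u * x ^ n ∈ NN e h f D t := by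
  have wt : ∀ (i : ℕ) (q : ℂ[X]) (v : R) (c : ℂ), h * v = v * h + c • v → c ≠ 0 →
      D ^ i * (aeval h q * v) ∈ NN e h f D t := by
    intro i q v c hv hc
    have hq : h * aeval h q = aeval h q * h := semi_aeval (Commute.refl h) q
    have : D ^ i * (aeval h q * v) = c⁻¹ • ad h (D ^ i * (aeval h q * v)) := by
      rw [eq_inv_smul_iff₀ hc, ad_apply, ← mul_assoc h, ← (A.Dh.pow_left i).eq, mul_assoc, ← mul_assoc h, hq, mul_assoc _ h,
        hv, mul_add, mul_smul_comm, mul_add, mul_smul_comm]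
      noncomm_ring
    rw [this]
    exact Submodule.smul_mem _ _ (ad_h_mem _)
  have eqc : ∀ (i k : ℕ) (q : ℂ[X]), n = 2 * k → D ^ i * (aeval h q * (f ^ k * x ^ n)) ∈ NN e h f D t := by
    rintro i k q rfl
    refine A.A_mul_N (pow_mem (Algebra.subset_adjoin (by simp)) i) ?_
    induction q using Polynomial.induction_on' with
    | add p q hp hq => rw [map_add, add_mul]; exact add_mem hp hq
    | monomial m r =>
      rw [aeval_monomial, ← Algebra.smul_def, smul_mul_assoc]
      exact Submodule.smul_mem _ _ (A.hjfk k hn m)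
  have : WW e h f D ≤ (NN e h f D t).comap (LinearMap.mulRight ℂ (x ^ n)) := Submodule.span_le.2 (by
    rintro v ⟨i, k, q, rfl | rfl⟩
    · simp only [SetLike.mem_coe, Submodule.mem_comap, LinearMap.mulRight_apply, mul_assoc]
      by_cases hk : n = 2 * k
      · exact eqc i k q hk
      · refine wt i q _ (n - 2 * k) ?_ ?_
        · rw [← mul_assoc, A.hfk', sub_mul, mul_assoc, A.hxk, mul_add, mul_smul_comm, smul_mul_assoc, mul_assoc]
          module
        · rw [sub_ne_zero]; exact_mod_cast hk
    · simp only [SetLike.mem_coe, Submodule.mem_comap, LinearMap.mulRight_apply, mul_assoc]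
      by_cases hk : n + 2 * k = 0
      · obtain rfl : n = 0 := by omega
        obtain rfl : k = 0 := by omega
        simpa using eqc i 0 q rfl
      · refine wt i q _ (n + 2 * k) ?_ ?_
        · rw [← mul_assoc, A.hek, add_mul, mul_assoc, A.hxk, mul_add, mul_smul_comm, smul_mul_assoc, mul_assoc]
          module
        · exact_mod_cast hk)
  exact this (A.U_le hu)

theorem F_le (A : HD e h f x y z w D t) (n : ℕ) : FF e h f x y n ≤ NN e h f D t := by
  induction n using Nat.strong_induction_on with
  | _ n IH =>
  have c : ∀ j i, i + j = n → ∀ u ∈ Algebra.adjoin ℂ {e, h, f}, u * (y ^ j * x ^ i) ∈ NN e h f D t := by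
    intro j
    induction j with
    | zero =>
      rintro i rfl u hu
      simpa using A.Ux _ IH hu
    | succ j ih =>
      intro i hij u hu
      have hu' : ad f u ∈ Algebra.adjoin ℂ {e, h, f} := by
        rw [ad_apply]; exact sub_mem (mul_mem fU hu) (mul_mem hu fU)
      have h1 := A.key (IH (i + j) (by omega)) (i := i) (j := j) le_rfl hu
      have h2 := ih (i + 1) (by omega) _ hu'
      have h3 := sub_mem h1 h2
      rw [add_sub_cancel_right] at h3
      have hne : (i + 1 : ℂ) ≠ 0 := by exact_mod_cast (by omega : i + 1 ≠ 0)
      exact (Submodule.smul_mem_iff _ hne).1 h3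
  refine Submodule.span_le.2 ?_
  rintro v ⟨u, hu, i, j, hij, rfl⟩
  rcases hij.lt_or_eq with hlt | heq
  · exact IH _ hlt (FF_mem hu le_rfl)
  · exact c j i heq u hu

theorem all_N (A : HD e h f x y z w D t) (v : R) : v ∈ NN e h f D t := by
  obtain ⟨n, hn⟩ := A.exhaust v
  exact A.F_le n hn
end HD
end


section
variable {R : Type*} [Ring R] [Algebra ℂ R] {e h f x y z w D t : R}

theorem nilp_mul (a : R) : ∀ (n m k : ℕ) (b c : R), m + k ≤ n → (ad a ^ m) b = 0 → (ad a ^ k) c = 0 →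
    (ad a ^ n) (b * c) = 0 := by
  intro n
  induction n with
  | zero =>
    intro m k b c hmk hb hc
    obtain rfl : m = 0 := by omega
    simp at hb
    simp [hb]
  | succ n ih =>
    intro m k b c hmk hb hc
    rcases m with _ | m
    · simp at hb; simp [hb]
    rcases k with _ | k
    · simp at hc; simp [hc]
    rw [pow_succ, Module.End.mul_apply, ad_mul, map_add]
    rw [ih m (k + 1) (ad a b) c (by omega) (by rwa [pow_succ, Module.End.mul_apply] at hb) hc,
      ih (m + 1) k b (ad a c) (by omega) hb (by rwa [pow_succ, Module.End.mul_apply] at hc), add_zero]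

theorem nilp {a : R} {s : Set R} (hs : Algebra.adjoin ℂ s = ⊤) (H : ∀ c ∈ s, (ad a ^ 3) c = 0) (v : R) :
    ∃ n, (ad a ^ n) v = 0 := by
  have hv : v ∈ Algebra.adjoin ℂ s := by rw [hs]; trivial
  induction hv using Algebra.adjoin_induction with
  | mem c hc => exact ⟨3, H c hc⟩
  | algebraMap r => exact ⟨1, by rw [pow_one, ad_apply, Algebra.commutes r a, sub_self]⟩
  | add b c _ _ hb hc =>
    obtain ⟨m, hm⟩ := hb
    obtain ⟨k, hk⟩ := hc
    refine ⟨m + k, ?_⟩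
    have h1 : (ad a ^ (m + k)) c = 0 := by rw [pow_add, Module.End.mul_apply, hk, map_zero]
    have h2 : (ad a ^ (m + k)) b = 0 := by rw [add_comm, pow_add, Module.End.mul_apply, hm, map_zero]
    rw [map_add, h1, h2, add_zero]
  | mul b c _ _ hb hc =>
    obtain ⟨m, hm⟩ := hb
    obtain ⟨k, hk⟩ := hc
    exact ⟨m + k, nilp_mul a _ m k b c le_rfl hm hk⟩

/-- weight spaces -/
def WE (h : R) (μ : ℂ) : Submodule ℂ R := Module.End.eigenspace (ad h) μ

theorem mem_E {μ : ℂ} {v : R} : v ∈ WE h μ ↔ ad h v = μ • v := Module.End.mem_eigenspace_iff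

theorem E_mul {μ ν : ℂ} {a b : R} (ha : a ∈ WE h μ) (hb : b ∈ WE h ν) : a * b ∈ WE h (μ + ν) := by
  rw [mem_E] at *
  rw [ad_mul, ha, hb, smul_mul_assoc, mul_smul_comm, add_smul]

namespace HD

theorem nil_e (A : HD e h f x y z w D t) (v : R) : ∃ n, (ad e ^ n) v = 0 := by
  refine nilp A.top ?_ v
  have h1 : ad e e = 0 := by simp [ad_apply]
  have h2 : ad e h = - (2 : ℂ) • e := by rw [ad_apply, A.he, neg_smul, two_smul]; noncomm_ring
  have h3 : ad e f = h := by rw [ad_apply, A.ef]; noncomm_ring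
  have h4 : ad e x = 0 := by rw [ad_apply, A.ex]; noncomm_ring
  have h5 : ad e y = x := by rw [ad_apply, A.ey]; noncomm_ring
  simp [pow_succ, h1, h2, h3, h4, h5]

theorem nil_f (A : HD e h f x y z w D t) (v : R) : ∃ n, (ad f ^ n) v = 0 := by
  refine nilp A.top ?_ v
  have h1 : ad f f = 0 := by simp [ad_apply]
  have h2 : ad f h = (2 : ℂ) • f := by rw [ad_apply, A.hf, two_smul]; noncomm_ring
  have h3 : ad f e = - h := by rw [ad_apply, A.ef]; noncomm_ring
  have h4 : ad f x = y := by rw [ad_apply, A.fx]; noncomm_ring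
  have h5 : ad f y = 0 := by rw [ad_apply, A.fy]; noncomm_ring
  simp [pow_succ, h1, h2, h3, h4, h5]

theorem adef (A : HD e h f x y z w D t) (v : R) : ad e (ad f v) = ad f (ad e v) + ad h v := by
  have := A.ef
  simp only [ad_apply]
  linear_combination (norm := noncomm_ring) this * v - v * this

theorem e_E (A : HD e h f x y z w D t) {μ : ℂ} {v : R} (hv : v ∈ WE h μ) : ad e v ∈ WE h (μ + 2) := by
  have : e ∈ WE h 2 := by rw [mem_E, ad_apply, A.he, two_smul]; noncomm_ring
  rw [ad_apply]
  refine sub_mem ?_ (E_mul hv this)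
  rw [add_comm]; exact E_mul this hv

theorem f_E (A : HD e h f x y z w D t) {μ : ℂ} {v : R} (hv : v ∈ WE h μ) : ad f v ∈ WE h (μ - 2) := by
  have : f ∈ WE h (-2) := by rw [mem_E, ad_apply, A.hf, neg_smul, two_smul]; noncomm_ring
  rw [ad_apply, sub_eq_add_neg μ]
  refine sub_mem ?_ (E_mul hv this)
  rw [add_comm]; exact E_mul this hv

theorem fk_E (A : HD e h f x y z w D t) {μ : ℂ} {v : R} (hv : v ∈ WE h μ) (k : ℕ) : (ad f ^ k) v ∈ WE h (μ - 2 * k) := by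
  induction k with
  | zero => simpa using hv
  | succ k ih =>
    rw [pow_succ', Module.End.mul_apply]
    convert A.f_E ih using 1
    push_cast; ring_nf

theorem E_top (A : HD e h f x y z w D t) : ⨆ μ, WE h μ = ⊤ := by
  rw [eq_top_iff]
  intro v _
  have hv : v ∈ Algebra.adjoin ℂ {e, h, f, x, y} := by rw [A.top]; trivial
  induction hv using Algebra.adjoin_induction with
  | mem c hc =>
    have : ∃ μ, c ∈ WE h μ := by
      rcases hc with rfl | rfl | rfl | rfl | rfl
      · exact ⟨2, by rw [mem_E, ad_apply, A.he, two_smul]; noncomm_ring⟩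
      · exact ⟨0, by rw [mem_E, ad_apply]; simp⟩
      · exact ⟨-2, by rw [mem_E, ad_apply, A.hf, neg_smul, two_smul]; noncomm_ring⟩
      · exact ⟨1, by rw [mem_E, ad_apply, A.hx, one_smul]; noncomm_ring⟩
      · exact ⟨-1, by rw [mem_E, ad_apply, A.hy, neg_smul, one_smul]; noncomm_ring⟩
    obtain ⟨μ, hμ⟩ := this
    exact Submodule.mem_iSup_of_mem μ hμ
  | algebraMap r =>
    exact Submodule.mem_iSup_of_mem 0 (by rw [mem_E, ad_apply, Algebra.commutes r h]; simp)
  | add b c _ _ hb hc => exact add_mem (hb trivial) (hc trivial)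
  | mul b c _ _ hb hc =>
    have := Submodule.mul_mem_mul (hb trivial) (hc trivial)
    rw [Submodule.iSup_mul] at this
    refine (iSup_le fun μ => ?_ : (⨆ i, WE h i * ⨆ i, WE h i) ≤ _) this
    rw [Submodule.mul_iSup]
    refine iSup_le fun ν => ?_
    rw [Submodule.mul_le]
    intro a ha b hb
    exact Submodule.mem_iSup_of_mem _ (E_mul ha hb)

theorem efk (A : HD e h f x y z w D t) {μ : ℂ} {v : R} (hv : v ∈ WE h μ) (k : ℕ) :
    ad e ((ad f ^ (k + 1)) v) = (ad f ^ (k + 1)) (ad e v) + ((k + 1) * (μ - k) : ℂ) • (ad f ^ k) v := by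
  induction k with
  | zero =>
    rw [mem_E] at hv
    simp [A.adef, hv]
  | succ k ih =>
    have h1 := mem_E.1 (A.fk_E hv (k + 1))
    rw [pow_succ' _ (k + 1), Module.End.mul_apply, A.adef, ih, h1, map_add, map_smul, Module.End.mul_apply,
      ← Module.End.mul_apply (ad f) (ad f ^ k), ← pow_succ']
    push_cast
    module

theorem fc_mem (A : HD e h f x y z w D t) (n : ℕ) : ∀ (m : ℕ) (c : R), c ∈ WE h (2 * (m + 1)) → (ad e ^ n) c = 0 →
    ∃ a ∈ WE h (-2), (ad f ^ (m + 1)) c = ad e a := by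
  induction n with
  | zero =>
    intro m c _ h0
    simp at h0
    exact ⟨0, zero_mem _, by simp [h0]⟩
  | succ n ih =>
    intro m c hc h0
    have h1 := A.efk hc (m + 1)
    obtain ⟨a, ha, h2⟩ := ih (m + 1) (ad e c) (by convert A.e_E hc using 1; push_cast; ring_nf)
      (by rwa [pow_succ, Module.End.mul_apply] at h0)
    have h3 : (ad f ^ (m + 2)) c ∈ WE h (-2) := by
      convert A.fk_E hc (m + 2) using 1; push_cast; ring_nf
    rw [h2] at h1
    have hne : (((m + 1 : ℕ) + 1) * (2 * (m + 1) - (m + 1 : ℕ)) : ℂ) ≠ 0 := by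
      have : (((m + 1 : ℕ) + 1) * (2 * (m + 1) - (m + 1 : ℕ)) : ℂ) = (((m + 2) * (m + 1) : ℕ) : ℂ) := by
        push_cast; ring
      rw [this]
      exact Nat.cast_ne_zero.2 (by positivity)
    refine ⟨(((m + 1 : ℕ) + 1) * (2 * (m + 1) - (m + 1 : ℕ)) : ℂ)⁻¹ • ((ad f ^ (m + 2)) c - a),
      Submodule.smul_mem _ _ (sub_mem h3 ha), ?_⟩
    rw [map_smul, eq_inv_smul_iff₀ hne, map_sub, h1, add_sub_cancel_left]

theorem inv_zero (A : HD e h f x y z w D t) {b c d v : R} (hv : ad e b + (ad h c + ad f d) = v)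
    (h2 : ad h v = 0) (h3 : ad f v = 0) : v = 0 := by
  let N2 : Submodule ℂ R := (⨆ μ, ⨆ (_ : μ ≠ 0), WE h μ) ⊔ ((WE h (-2)).map (ad e) ⊔ (WE h 2).map (ad f))
  have ind : ∀ (φ : R →ₗ[ℂ] R), (∀ μ, ∀ a ∈ WE h μ, φ a ∈ N2) → ∀ a, φ a ∈ N2 := by
    intro φ H a
    have : (⨆ μ, WE h μ) ≤ N2.comap φ := iSup_le H
    rw [A.E_top] at this
    exact this trivial
  have nz : ∀ μ, μ ≠ 0 → ∀ a ∈ WE h μ, a ∈ N2 := fun μ hμ a ha =>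
    Submodule.mem_sup_left (Submodule.mem_iSup_of_mem μ (Submodule.mem_iSup_of_mem hμ ha))
  have m1 : ad e b ∈ N2 := by
    refine ind _ (fun μ a ha => ?_) b
    by_cases hμ : μ = -2
    · subst hμ
      exact Submodule.mem_sup_right (Submodule.mem_sup_left (Submodule.mem_map_of_mem ha))
    · exact nz _ (fun h => hμ (by linear_combination h)) _ (A.e_E ha)
  have m2 : ad h c ∈ N2 := by
    refine ind _ (fun μ a ha => ?_) c
    by_cases hμ : μ = 0
    · rw [mem_E.1 ha, hμ, zero_smul]; exact zero_mem _
    · rw [mem_E.1 ha]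
      exact Submodule.smul_mem _ _ (nz _ hμ _ ha)
  have m3 : ad f d ∈ N2 := by
    refine ind _ (fun μ a ha => ?_) d
    by_cases hμ : μ = 2
    · subst hμ
      exact Submodule.mem_sup_right (Submodule.mem_sup_right (Submodule.mem_map_of_mem ha))
    · exact nz _ (fun h => hμ (by linear_combination h)) _ (A.f_E ha)
  have m4 : v ∈ N2 := by rw [← hv]; exact add_mem m1 (add_mem m2 m3)
  obtain ⟨s, hs, q, hq, E1⟩ := Submodule.mem_sup.1 m4
  obtain ⟨_, ⟨a, ha, rfl⟩, _, ⟨g, hg, rfl⟩, rfl⟩ := Submodule.mem_sup.1 hq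
  obtain ⟨n, hn⟩ := A.nil_e g
  obtain ⟨a', ha', E2⟩ := A.fc_mem n 0 g (by simpa using hg) hn
  simp only [zero_add, pow_one] at E2
  rw [E2, ← map_add] at E1
  have ha2 : a + a' ∈ WE h (-2) := add_mem ha ha'
  generalize a + a' = r at E1 ha2
  have hv0 : v ∈ WE h 0 := by rw [mem_E, h2, zero_smul]
  have hr0 : ad e r ∈ WE h 0 := by have := A.e_E ha2; simpa using this
  have hs0 : s ∈ WE h 0 := by
    have : s = v - ad e r := by rw [← E1]; abel
    rw [this]; exact sub_mem hv0 hr0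
  have ind := Module.End.eigenspaces_iSupIndep (ad h)
  have hsz : s = 0 := by
    have := (ind 0).le_bot ⟨hs0, hs⟩
    simpa using this
  rw [hsz, zero_add] at E1
  have hfe : ad f (ad e r) = 0 := by rw [E1, h3]
  have down : ∀ n, (ad f ^ n) r = 0 → r = 0 := by
    intro n
    induction n with
    | zero => simp
    | succ n ih =>
      intro h0
      apply ih
      have := A.efk ha2 n
      rw [h0, map_zero, pow_succ, Module.End.mul_apply, hfe, map_zero, zero_add, eq_comm, smul_eq_zero] at this
      refine this.resolve_left ?_
      have e1 : ((n + 1) * (-2 - n) : ℂ) = -(((n + 1) * (n + 2) : ℕ) : ℂ) := by push_cast; ring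
      rw [e1, neg_eq_zero]
      exact Nat.cast_ne_zero.2 (by positivity)
  obtain ⟨n, hn⟩ := A.nil_f r
  rw [← E1, down n hn, map_zero]
end HD
end

section
variable {R : Type*} [Ring R] [Algebra ℂ R] {e h f x y z w D t : R}
theorem HD.final (A : HD e h f x y z w D t) {u : R} (_h1 : e * u = u * e) (h2 : h * u = u * h)
    (h3 : f * u = u * f) : u ∈ Algebra.adjoin ℂ {t, D} := by
  obtain ⟨a, ha, b, c, d, hu⟩ := mem_NN.1 (A.all_N u)
  obtain ⟨_, k2, k3⟩ := A.adj_comm ha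
  have key : ad e b + (ad h c + ad f d) = u - a := by rw [← hu]; abel
  have h0 := A.inv_zero key (by rw [map_sub, ad_apply, ad_apply, h2, k2.eq]; simp)
    (by rw [map_sub, ad_apply, ad_apply, h3, k3.eq]; simp)
  rw [sub_eq_zero] at h0
  rwa [h0]
end

/-- In H_z, any element commuting with e, h, f lies in the subalgebra generated by
the central element t_z = ey² + hxy − fx² − (1/2)hz − ω_z and ℂ[Δ], where ω_z ∈ ℂ[Δ]
satisfies [x, ω_z] = (1/4)([Δz − z, x] + z[Δ, x] − Δ[z, x]). -/
theorem g_invariants_in_center_algebra (p ω : Polynomial ℂ) :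
    let z : F5 := Polynomial.aeval gΔ p
    let E := π z ge; let H := π z gh; let Fl := π z gf
    let Xl := π z gx; let Yl := π z gy; let D := π z gΔ
    let Z : Hz z := Polynomial.aeval D p
    let ωD : Hz z := Polynomial.aeval D ω
    (Xl * ωD - ωD * Xl
      = (1/4 : ℂ) • (((D * Z - Z) * Xl - Xl * (D * Z - Z))
          + Z * (D * Xl - Xl * D) - D * (Z * Xl - Xl * Z))) →
    ∀ u : Hz z, E * u = u * E → H * u = u * H → Fl * u = u * Fl →
      u ∈ Algebra.adjoin ℂ
        ({E * Yl ^ 2 + H * Xl * Yl - Fl * Xl ^ 2 - (1/2 : ℂ) • (H * Z) - ωD, D}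
          : Set (Hz z)) := by
  intro z E H Fl Xl Yl D Z ωD _ u h1 h2 h3
  have rel : ∀ {a b : F5}, HRel z a b → π z a = π z b := fun hr => RingQuot.mkAlgHom_rel ℂ hr
  have A : HD E H Fl Xl Yl Z ωD D
      (E * Yl ^ 2 + H * Xl * Yl - Fl * Xl ^ 2 - (1/2 : ℂ) • (H * Z) - ωD) := by
    refine ⟨?_, ?_, ?_, ?_, ?_, ?_, ?_, ?_, ?_, ?_, ?_, ?_, ?_, rfl, ?_⟩
    · simpa [map_ofNat] using rel HRel.he
    · simpa [map_ofNat] using rel HRel.hf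
    · simpa using rel HRel.ef
    · simpa using rel HRel.ex
    · simpa using rel HRel.ey
    · simpa using rel HRel.fx
    · simpa using rel HRel.fy
    · simpa using rel HRel.hx
    · simpa using rel HRel.hy
    · have hr := rel HRel.xy
      rw [map_mul, map_add, map_mul] at hr
      have hz : π z z = Z := (Polynomial.aeval_algHom_apply (π z) gΔ p).symm
      rw [hz] at hr
      exact hr
    · simp [D, gΔ, E, H, Fl, map_ofNat]
    · exact Polynomial.aeval_mem_adjoin_singleton ℂ D
    · exact Polynomial.aeval_mem_adjoin_singleton ℂ D
    · have hs : Function.Surjective (π z) := RingQuot.mkAlgHom_surjective ℂ (HRel z)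
      have h5 : (Algebra.adjoin ℂ (Set.range (FreeAlgebra.ι ℂ (X := Fin 5)))).map (π z) = ⊤ := by
        rw [FreeAlgebra.adjoin_range_ι, Algebra.map_top, AlgHom.range_eq_top]
        exact hs
      rw [AlgHom.map_adjoin] at h5
      rw [eq_top_iff, ← h5]
      refine Algebra.adjoin_mono ?_
      rintro _ ⟨_, ⟨i, rfl⟩, rfl⟩
      fin_cases i
      · exact Or.inl rfl
      · exact Or.inr (Or.inl rfl)
      · exact Or.inr (Or.inr (Or.inl rfl))
      · exact Or.inr (Or.inr (Or.inr (Or.inl rfl)))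
      · exact Or.inr (Or.inr (Or.inr (Or.inr rfl)))
  exact A.final h1 h2 h3
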